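/- Let (a_n), (b_n) be N-periodically modulated Jacobi parameters such that tr 𝔛₀'(0) ≠ 0, and set ς = sign(tr 𝔛₀'(0)). Let K be a compact subset of ℂ_ς with nonempty interior. Then there is M ≥ 1 such that for all n ≥ M and z ∈ K, Im( tr X_n(z) / (2·√(det X_n(z))) ) > 0; equivalently, since det X_n(z) = a_{n−1}/a_{n+N−1} > 0 is a positive constant in z, Im(tr X_n(z)) > 0. -/

import Mathlib

open Filter Topology

/-- The principal branch of the complex square root. -/
noncomputable def sqrtC (z : ℂ) : ℂ := z ^ (1 / 2 : ℂ)

/-- The one–step transfer matrix `B_j(x)` associated with Jacobi parameters `a, b`. -/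
noncomputable def jacobiB (a b : ℕ → ℝ) (j : ℕ) (x : ℂ) : Matrix (Fin 2) (Fin 2) ℂ :=
  !![0, 1; -((a (j - 1) : ℂ) / (a j : ℂ)), (x - (b j : ℂ)) / (a j : ℂ)]

/-- The `N`-step transfer matrix `X_n(x) = B_{n+N-1}(x) ⋯ B_{n+1}(x) B_n(x)`. -/
noncomputable def transferX (a b : ℕ → ℝ) (N n : ℕ) (x : ℂ) : Matrix (Fin 2) (Fin 2) ℂ :=
  (((List.range N).map (fun k => jacobiB a b (n + k) x)).reverse).prod

/-- The one–step matrix `𝔅_j(x)` associated with the `N`-periodic parameters `α, β`. -/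
noncomputable def frakB (α β : ℤ → ℝ) (j : ℤ) (x : ℂ) : Matrix (Fin 2) (Fin 2) ℂ :=
  !![0, 1; -((α (j - 1) : ℂ) / (α j : ℂ)), (x - (β j : ℂ)) / (α j : ℂ)]

/-- The periodic `N`-step matrix `𝔛_n(x) = 𝔅_{n+N-1}(x) ⋯ 𝔅_n(x)`. -/
noncomputable def frakX (α β : ℤ → ℝ) (N : ℕ) (n : ℤ) (x : ℂ) : Matrix (Fin 2) (Fin 2) ℂ :=
  (((List.range N).map (fun k => frakB α β (n + k) x)).reverse).prod

/-- Generic one-step matrix, with real parameters `p k = (r, s, q)`. -/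
noncomputable def genB (p : ℕ → ℝ × ℝ × ℝ) (k : ℕ) (w : ℂ) : Matrix (Fin 2) (Fin 2) ℂ :=
  !![0, 1; -((p k).1 : ℂ), w * ((p k).2.1 : ℂ) - ((p k).2.2 : ℂ)]

noncomputable def genX (p : ℕ → ℝ × ℝ × ℝ) (N : ℕ) (w : ℂ) : Matrix (Fin 2) (Fin 2) ℂ :=
  (((List.range N).map (fun k => genB p k w)).reverse).prod

theorem genX_succ (p : ℕ → ℝ × ℝ × ℝ) (N : ℕ) (w : ℂ) :
    genX p (N + 1) w = genB p N w * genX p N w := by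
  simp [genX, List.range_succ]

theorem genX_decomp (N : ℕ) : ∃ (Y : (ℕ → ℝ × ℝ × ℝ) → Matrix (Fin 2) (Fin 2) ℝ)
    (G : (ℕ → ℝ × ℝ × ℝ) × ℂ → Matrix (Fin 2) (Fin 2) ℂ), Continuous Y ∧ Continuous G ∧
    ∀ p w, genX p N w = (Y p).map Complex.ofReal + w • G (p, w) := by
  induction N with
  | zero =>
    refine ⟨fun _ => 1, fun _ => 0, continuous_const, continuous_const, fun p w => ?_⟩
    simp [genX]
  | succ N ih =>
    obtain ⟨Y, G, hY, hG, h⟩ := ih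
    refine ⟨fun p => !![0, 1; -(p N).1, -(p N).2.2] * Y p,
      fun x => !![0, 0; 0, ((x.1 N).2.1 : ℂ)] * ((Y x.1).map Complex.ofReal + x.2 • G x)
        + (!![0, 1; -((x.1 N).1 : ℂ), -((x.1 N).2.2 : ℂ)]) * G x, ?_, ?_, fun p w => ?_⟩
    · refine Continuous.matrix_mul ?_ hY
      refine continuous_matrix fun i j => ?_
      fin_cases i <;> fin_cases j <;> simp <;> fun_prop
    · refine Continuous.add (Continuous.matrix_mul ?_ (Continuous.add ?_ ?_))
        (Continuous.matrix_mul ?_ hG)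
      · refine continuous_matrix fun i j => ?_
        fin_cases i <;> fin_cases j <;> simp <;> fun_prop
      · exact (hY.comp continuous_fst).matrix_map Complex.continuous_ofReal
      · exact continuous_snd.smul hG
      · refine continuous_matrix fun i j => ?_
        fin_cases i <;> fin_cases j <;> simp <;> fun_prop
    · rw [genX_succ, h]
      ext i j
      fin_cases i <;> fin_cases j <;>
        simp only [genB, Matrix.add_apply, Matrix.smul_apply, Matrix.map_apply,
          Matrix.mul_apply, Fin.sum_univ_two] <;> simp <;> ring

theorem frakX_eq (α β : ℤ → ℝ) (N : ℕ) (n : ℤ) (x : ℂ) : frakX α β N n x =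
    (((List.range N).map (fun k : ℕ => frakB α β (n + (k : ℤ)) x)).reverse).prod := by
  have h : ∀ l : List ℕ, List.flatMap (fun a : ℕ => [(a : ℤ)]) l = l.map (fun a : ℕ => (a : ℤ)) := by
    intro l
    induction l with
    | nil => rfl
    | cons a l ih => simp [ih]
  simp [frakX, h, Function.comp_def]

theorem frakX_trace_succ (α β : ℤ → ℝ) (N : ℕ) (hN : 1 ≤ N)
    (hαper : ∀ k : ℤ, α (k + N) = α k) (hβper : ∀ k : ℤ, β (k + N) = β k) (n : ℤ) (x : ℂ) :
    (frakX α β N (n + 1) x).trace = (frakX α β N n x).trace := by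
  obtain ⟨M, rfl⟩ : ∃ M, N = M + 1 := ⟨N - 1, by omega⟩
  have hB : frakB α β (n + 1 + M) x = frakB α β n x := by
    have h1 := hαper n
    have h2 := hβper n
    have h3 := hαper (n - 1)
    have e1 : n + 1 + (M : ℤ) = n + ((M + 1 : ℕ) : ℤ) := by push_cast; ring
    have e2 : n + ((M + 1 : ℕ) : ℤ) - 1 = n - 1 + ((M + 1 : ℕ) : ℤ) := by ring
    simp only [frakB]
    rw [e1, e2, h1, h2, h3]
  have e1 : frakX α β (M + 1) (n + 1) x = frakB α β n x *
      (((List.range M).map (fun k : ℕ => frakB α β (n + 1 + k) x)).reverse).prod := by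
    rw [frakX_eq]
    simp [List.range_succ, hB]
  have e2 : frakX α β (M + 1) n x =
      (((List.range M).map (fun k : ℕ => frakB α β (n + 1 + k) x)).reverse).prod
        * frakB α β n x := by
    rw [frakX_eq]
    simp only [List.range_succ_eq_map, List.map_cons, List.map_map, List.reverse_cons,
      List.prod_append, List.prod_singleton, Function.comp_def, Nat.cast_zero, add_zero]
    congr 4
    ext k : 1
    congr 1
    push_cast
    ring
  rw [e1, e2, Matrix.trace_mul_comm]

theorem frakX_trace (α β : ℤ → ℝ) (N : ℕ) (hN : 1 ≤ N)
    (hαper : ∀ k : ℤ, α (k + N) = α k) (hβper : ∀ k : ℤ, β (k + N) = β k) (n : ℕ) (x : ℂ) :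
    (frakX α β N n x).trace = (frakX α β N 0 x).trace := by
  induction n with
  | zero => simp
  | succ n ih =>
    rw [← ih, ← frakX_trace_succ α β N hN hαper hβper n]
    push_cast; rfl

theorem transferX_det (a b : ℕ → ℝ) (ha : ∀ n, 0 < a n) (N n : ℕ) (z : ℂ) :
    ∃ r : ℝ, 0 < r ∧ (transferX a b N n z).det = (r : ℂ) := by
  induction N with
  | zero => exact ⟨1, one_pos, by simp [transferX]⟩
  | succ N ih =>
    obtain ⟨r, hr, h⟩ := ih
    refine ⟨a (n + N - 1) / a (n + N) * r, mul_pos (div_pos (ha _) (ha _)) hr, ?_⟩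
    have : transferX a b (N + 1) n z = jacobiB a b (n + N) z * transferX a b N n z := by
      simp [transferX, List.range_succ]
    rw [this, Matrix.det_mul, h]
    simp [jacobiB, Matrix.det_fin_two]

theorem im_div_sqrtC (t : ℂ) (r : ℝ) (hr : 0 < r) (ht : 0 < t.im) :
    0 < (t / (2 * sqrtC (r : ℂ))).im := by
  have h : (2 * sqrtC (r : ℂ)) = ((2 * r ^ (1 / 2 : ℝ) : ℝ) : ℂ) := by
    rw [sqrtC]; push_cast [Complex.ofReal_cpow hr.le]; norm_num
  rw [h, Complex.div_ofReal_im]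
  positivity

theorem periodic_aux (γ : ℤ → ℝ) (N : ℕ) (h : ∀ k : ℤ, γ (k + N) = γ k) (k : ℤ) (m : ℕ) :
    γ (k + N * m) = γ k := by
  have : Function.Periodic γ (N : ℤ) := h
  have := this.nat_mul m k
  rw [mul_comm]; exact_mod_cast this

theorem residue_case
    (N : ℕ) (hN : 1 ≤ N)
    (a b : ℕ → ℝ) (ha : ∀ n, 0 < a n)
    (α β : ℤ → ℝ) (hαpos : ∀ k, 0 < α k)
    (hαper : ∀ k : ℤ, α (k + N) = α k) (hβper : ∀ k : ℤ, β (k + N) = β k)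
    (hmod1 : Tendsto a atTop atTop)
    (hmod2 : Tendsto (fun n : ℕ => a n / a (n + 1) - α n / α (n + 1)) atTop (𝓝 0))
    (hmod3 : Tendsto (fun n : ℕ => b n / a n - β n / α n) atTop (𝓝 0))
    (t' : ℝ)
    (ht' : HasDerivAt (fun x : ℂ => Matrix.trace (frakX α β N 0 x)) (t' : ℂ) 0)
    (K : Set ℂ) (hK : IsCompact K)
    (hKsub : ∀ z ∈ K, 0 < t' * z.im) (i : ℕ) :
    ∀ᶠ m : ℕ in atTop, ∀ z ∈ K, 0 < (transferX a b N (i + N * m + 1) z).trace.im := by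
  obtain ⟨Y, G, hY, hG, h⟩ := genX_decomp N
  set c : ℝ := α (i + 1) with hc
  have hcpos : 0 < c := hαpos _
  set p : ℕ → ℕ → ℝ × ℝ × ℝ := fun m k =>
    (a (i + N * m + k) / a (i + N * m + k + 1),
      (a (i + N * m + 1) / a (i + N * m + 1 + k)) / c,
      b (i + N * m + k + 1) / a (i + N * m + k + 1)) with hp
  set q : ℕ → ℝ × ℝ × ℝ := fun k =>
    (α (i + k) / α (i + k + 1), 1 / α (i + 1 + k), β (i + k + 1) / α (i + k + 1)) with hq
  have hNm : Tendsto (fun m : ℕ => N * m) atTop atTop :=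
    tendsto_id.const_mul_atTop' (by omega)
  have hsub : ∀ k : ℕ, Tendsto (fun m : ℕ => i + N * m + k) atTop atTop := fun k =>
    tendsto_atTop_mono (fun m => by omega) hNm
  have hα : ∀ (k : ℤ) (m : ℕ), α (k + N * m) = α k := periodic_aux α N hαper
  have hβ : ∀ (k : ℤ) (m : ℕ), β (k + N * m) = β k := periodic_aux β N hβper
  have hr : ∀ k : ℕ, Tendsto (fun m : ℕ => a (i + N * m + k) / a (i + N * m + k + 1)) atTop
      (𝓝 (α (i + k) / α (i + k + 1))) := by
    intro k
    have := (hmod2.comp (hsub k)).add_const (α (i + k) / α (i + k + 1))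
    rw [zero_add] at this
    refine this.congr fun m => ?_
    have e1 : (((i + N * m + k : ℕ) : ℤ)) = (i + k : ℤ) + N * m := by push_cast; ring
    have e2 : (i + k : ℤ) + N * m + 1 = (i + k + 1 : ℤ) + N * m := by ring
    simp only [Function.comp]
    rw [e1, e2, hα, hα]; ring
  have hqq : ∀ k : ℕ, Tendsto (fun m : ℕ => b (i + N * m + k + 1) / a (i + N * m + k + 1)) atTop
      (𝓝 (β (i + k + 1) / α (i + k + 1))) := by
    intro k
    have := (hmod3.comp (hsub (k + 1))).add_const (β (i + k + 1) / α (i + k + 1))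
    rw [zero_add] at this
    refine this.congr fun m => ?_
    have e1 : (((i + N * m + (k + 1) : ℕ) : ℤ)) = (i + k + 1 : ℤ) + N * m := by push_cast; ring
    simp only [Function.comp]
    rw [e1, hα, hβ, ← add_assoc]; ring
  have hs : ∀ k : ℕ, Tendsto (fun m : ℕ => a (i + N * m + 1) / a (i + N * m + 1 + k)) atTop
      (𝓝 (c / α (i + 1 + k))) := by
    intro k
    induction k with
    | zero =>
      simp only [add_zero, Nat.cast_zero]
      rw [← hc, div_self hcpos.ne']
      refine tendsto_const_nhds.congr fun m => ?_
      rw [div_self (ha _).ne']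
    | succ k ih =>
      have := ih.mul (hr (k + 1))
      have e : c / α (i + 1 + k) * (α (i + (k + 1 : ℕ)) / α (i + (k + 1 : ℕ) + 1)) =
          c / α (i + 1 + (k + 1 : ℕ)) := by
        have e1 : (i : ℤ) + (k + 1 : ℕ) = i + 1 + k := by push_cast; ring
        have e2 : (i : ℤ) + 1 + (k + 1 : ℕ) = i + 1 + k + 1 := by push_cast; ring
        rw [e1, e2]
        have := (hαpos (i + 1 + k)).ne'
        field_simp
      rw [e] at this
      refine this.congr fun m => ?_
      have e1 : i + N * m + (k + 1) = i + N * m + 1 + k := by ring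
      rw [e1]
      have := (ha (i + N * m + 1 + k)).ne'
      rw [div_mul_div_cancel₀ this]; rfl
  have hpq : Tendsto p atTop (𝓝 q) := by
    rw [tendsto_pi_nhds]
    intro k
    refine (hr k).prodMk_nhds (Tendsto.prodMk_nhds ?_ (hqq k))
    have := (hs k).div_const c
    convert this using 2
    field_simp
  have hε : Tendsto (fun m : ℕ => c / a (i + N * m + 1)) atTop (𝓝 0) :=
    (hmod1.comp (hsub 1)).const_div_atTop c
  have hXp : ∀ m z, transferX a b N (i + N * m + 1) z =
      genX (p m) N (((c / a (i + N * m + 1) : ℝ) : ℂ) * z) := by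
    intro m z
    rw [transferX, genX]
    congr 3
    ext k : 1
    have e : i + N * m + 1 + k = i + N * m + k + 1 := by ring
    have h1 : (a (i + N * m + 1) : ℂ) ≠ 0 := by exact_mod_cast (ha _).ne'
    have h2 : (a (i + N * m + k + 1) : ℂ) ≠ 0 := by exact_mod_cast (ha _).ne'
    have h3 : (c : ℂ) ≠ 0 := by exact_mod_cast hcpos.ne'
    simp only [jacobiB, genB, hp]
    rw [e]
    congr 4
    · push_cast; rfl
    · push_cast; field_simp
  have hXq : ∀ w, frakX α β N (i + 1 : ℕ) w = genX q N w := by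
    intro w
    rw [frakX_eq, genX]
    congr 3
    ext k : 1
    have e : ((i + 1 : ℕ) : ℤ) + k = i + k + 1 := by push_cast; ring
    have e' : (i : ℤ) + 1 + k = i + k + 1 := by ring
    simp only [frakB, genB, hq]
    rw [e, e']
    congr 4
    · push_cast; simp
    · push_cast; ring
  have hGd : (G (q, 0)).trace = (t' : ℂ) := by
    have hd : HasDerivAt (fun x : ℂ => ((Y q).map Complex.ofReal).trace + x * (G (q, x)).trace)
        (t' : ℂ) 0 := by
      refine ht'.congr_of_eventuallyEq (Eventually.of_forall fun x => ?_)
      simp only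
      rw [← frakX_trace α β N hN hαper hβper (i + 1), hXq, h]
      simp
    have h1 := hasDerivAt_iff_tendsto_slope_zero.1 hd
    have h2 : Tendsto (fun x : ℂ => (G (q, x)).trace) (𝓝[≠] 0) (𝓝 (G (q, 0)).trace) := by
      have : Continuous (fun x : ℂ => (G (q, x)).trace) :=
        (hG.comp (by fun_prop)).matrix_trace
      exact (this.tendsto 0).mono_left nhdsWithin_le_nhds
    refine tendsto_nhds_unique (h2.congr' ?_) h1
    filter_upwards [self_mem_nhdsWithin] with x hx
    have hx' : x ≠ 0 := hx
    simp [hx']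
  have hev : ∀ᶠ x : (ℕ → ℝ × ℝ × ℝ) × ℝ in 𝓝 (q, 0), ∀ z ∈ K,
      0 < (z * (G (x.1, (x.2 : ℂ) * z)).trace).im := by
    refine hK.eventually_forall_of_forall_eventually fun z hz => ?_
    have hcont : Continuous (fun y : ((ℕ → ℝ × ℝ × ℝ) × ℝ) × ℂ =>
        (y.2 * (G (y.1.1, (y.1.2 : ℂ) * y.2)).trace).im) := by
      refine Complex.continuous_im.comp (continuous_snd.mul ?_)
      exact (hG.comp (by fun_prop)).matrix_trace
    refine hcont.continuousAt.eventually_const_lt ?_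
    simp only [Complex.ofReal_zero, zero_mul, hGd]
    have := hKsub z hz
    simp
    linarith
  filter_upwards [(hpq.prodMk_nhds hε).eventually hev] with m hm z hz
  have h1 := hm z hz
  rw [hXp, h, Matrix.trace_add, Matrix.trace_smul, Complex.add_im]
  have h2 : (((Y (p m)).map Complex.ofReal).trace).im = 0 := by
    simp [Matrix.trace, Fin.sum_univ_two]
  rw [h2, zero_add, smul_eq_mul, mul_assoc, Complex.im_ofReal_mul]
  exact mul_pos (div_pos hcpos (ha _)) h1

/-- Lemma 6 of the paper. -/
theorem stmt_10
    (N : ℕ) (hN : 1 ≤ N)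
    (a b : ℕ → ℝ) (ha : ∀ n, 0 < a n)
    (α β : ℤ → ℝ) (hαpos : ∀ k, 0 < α k)
    (hαper : ∀ k : ℤ, α (k + N) = α k) (hβper : ∀ k : ℤ, β (k + N) = β k)
    (hmod1 : Tendsto a atTop atTop)
    (hmod2 : Tendsto (fun n : ℕ => a n / a (n + 1) - α n / α (n + 1)) atTop (𝓝 0))
    (hmod3 : Tendsto (fun n : ℕ => b n / a n - β n / α n) atTop (𝓝 0))
    (t' : ℝ)
    (ht' : HasDerivAt (fun x : ℂ => Matrix.trace (frakX α β N 0 x)) (t' : ℂ) 0)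
    (ht'ne : t' ≠ 0)
    (K : Set ℂ) (hK : IsCompact K) (hKint : (interior K).Nonempty)
    (hKsub : K ⊆ {z : ℂ | 0 < Real.sign t' * z.im}) :
    ∃ M : ℕ, 1 ≤ M ∧ ∀ n ≥ M, ∀ z ∈ K,
      0 < (Matrix.trace (transferX a b N n z) /
        (2 * sqrtC ((transferX a b N n z).det))).im := by
  have hKs : ∀ z ∈ K, 0 < t' * z.im := by
    intro z hz
    have h1 : 0 < Real.sign t' * z.im := hKsub hz
    rcases lt_or_gt_of_ne ht'ne with h | h
    · rw [Real.sign_of_neg h] at h1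
      nlinarith
    · rw [Real.sign_of_pos h] at h1
      nlinarith
  have key : ∀ᶠ m : ℕ in atTop, ∀ i ∈ Finset.range N, ∀ z ∈ K,
      0 < (transferX a b N (i + N * m + 1) z).trace.im := by
    rw [Filter.eventually_all_finset]
    intro i _
    exact residue_case N hN a b ha α β hαpos hαper hβper hmod1 hmod2 hmod3 t' ht' K hK hKs i
  obtain ⟨m₀, hm₀⟩ := eventually_atTop.1 key
  refine ⟨N * m₀ + 1, by omega, fun n hn z hz => ?_⟩
  obtain ⟨r, hr, hdet⟩ := transferX_det a b ha N n z
  rw [hdet]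
  refine im_div_sqrtC _ r hr ?_
  have h1 := hm₀ ((n - 1) / N) ((Nat.le_div_iff_mul_le hN).2 (by rw [mul_comm]; omega))
    ((n - 1) % N) (Finset.mem_range.2 (Nat.mod_lt _ hN)) z hz
  rw [Nat.mod_add_div, Nat.sub_add_cancel (by omega)] at h1
  exact h1
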